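/- The RPA solution map S^RPA, sending each strongly continuous χ₀ : ℝ₊ → B(L²(ℝ³)+L^∞(ℝ³), L¹(ℝ³)∩L²(ℝ³)) to the unique strongly continuous solution χ^RPA of the RPA Dyson equation χ^RPA(t) = χ₀(t) + ∫₀ᵗ χ₀(t−s) F_H χ^RPA(s) ds, is a bijection from C_s(ℝ₊; B(L²+L^∞, L¹∩L²)) onto itself. -/

import Mathlib

/-!
STATEMENT 1: The RPA solution map `S^RPA : χ₀ ↦ χ^RPA` is a bijection of
`C_s(ℝ₊; B(L²(ℝ³)+L^∞(ℝ³), L¹(ℝ³)∩L²(ℝ³)))` onto itself.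
-/

open MeasureTheory ENNReal NNReal Complex
noncomputable section

/-- Euclidean space `ℝ³`. -/
abbrev R3 : Type := EuclideanSpace ℝ (Fin 3)

/-- The Lebesgue space `L^p(ℝ³; ℂ)`. -/
abbrev Lsp (p : ℝ≥0∞) : Type := Lp ℂ p (volume : Measure R3)

/-- The Banach space `L¹(ℝ³) ∩ L²(ℝ³)` (with the max norm), realized as the submodule of
`L¹ × L²` of pairs whose two components agree almost everywhere. -/
def interSub : Submodule ℂ (Lsp 1 × Lsp 2) where
  carrier := {f | (f.1 : R3 → ℂ) =ᵐ[volume] (f.2 : R3 → ℂ)}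
  add_mem' := by
    intro a b ha hb
    simp only [Set.mem_setOf_eq] at *
    have h1 := Lp.coeFn_add a.1 b.1
    have h2 := Lp.coeFn_add a.2 b.2
    filter_upwards [h1, h2, ha, hb] with x e1 e2 e3 e4
    show ((a.1 + b.1 : Lsp 1) : R3 → ℂ) x = ((a.2 + b.2 : Lsp 2) : R3 → ℂ) x
    rw [e1, e2]
    simp [e3, e4]
  zero_mem' := by
    simp only [Set.mem_setOf_eq]
    have h1 := Lp.coeFn_zero ℂ 1 (volume : Measure R3)
    have h2 := Lp.coeFn_zero ℂ 2 (volume : Measure R3)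
    filter_upwards [h1, h2] with x e1 e2
    show ((0 : Lsp 1) : R3 → ℂ) x = ((0 : Lsp 2) : R3 → ℂ) x
    rw [e1, e2]
  smul_mem' := by
    intro c a ha
    simp only [Set.mem_setOf_eq] at *
    have h1 := Lp.coeFn_smul c a.1
    have h2 := Lp.coeFn_smul c a.2
    filter_upwards [h1, h2, ha] with x e1 e2 e3
    show ((c • a.1 : Lsp 1) : R3 → ℂ) x = ((c • a.2 : Lsp 2) : R3 → ℂ) x
    rw [e1, e2]
    simp [e3]

/-- The Banach space `L¹(ℝ³) ∩ L²(ℝ³)`. -/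
abbrev L1capL2 : Type := ↥interSub

/-- The subspace of `L² × L^∞` of pairs summing to `0` a.e. (the "diagonal"). -/
def diagSub₀ : Submodule ℂ (Lsp 2 × Lsp ∞) where
  carrier := {f | (fun x => (f.1 : R3 → ℂ) x + (f.2 : R3 → ℂ) x) =ᵐ[volume] 0}
  add_mem' := by
    intro a b ha hb
    simp only [Set.mem_setOf_eq] at *
    have h1 := Lp.coeFn_add a.1 b.1
    have h2 := Lp.coeFn_add a.2 b.2
    filter_upwards [h1, h2, ha, hb] with x e1 e2 e3 e4
    show ((a.1 + b.1 : Lsp 2) : R3 → ℂ) x + ((a.2 + b.2 : Lsp ∞) : R3 → ℂ) x = 0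
    rw [e1, e2]
    have e3' : (a.1 : R3 → ℂ) x + (a.2 : R3 → ℂ) x = 0 := e3
    have e4' : (b.1 : R3 → ℂ) x + (b.2 : R3 → ℂ) x = 0 := e4
    simp only [Pi.add_apply]
    linear_combination e3' + e4'
  zero_mem' := by
    simp only [Set.mem_setOf_eq]
    have h1 := Lp.coeFn_zero ℂ 2 (volume : Measure R3)
    have h2 := Lp.coeFn_zero ℂ ∞ (volume : Measure R3)
    filter_upwards [h1, h2] with x e1 e2
    show ((0 : Lsp 2) : R3 → ℂ) x + ((0 : Lsp ∞) : R3 → ℂ) x = 0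
    rw [e1, e2]; simp
  smul_mem' := by
    intro c a ha
    simp only [Set.mem_setOf_eq] at *
    have h1 := Lp.coeFn_smul c a.1
    have h2 := Lp.coeFn_smul c a.2
    filter_upwards [h1, h2, ha] with x e1 e2 e3
    show ((c • a.1 : Lsp 2) : R3 → ℂ) x + ((c • a.2 : Lsp ∞) : R3 → ℂ) x = 0
    rw [e1, e2]
    have e3' : (a.1 : R3 → ℂ) x + (a.2 : R3 → ℂ) x = 0 := e3
    simp only [Pi.smul_apply, smul_eq_mul]
    linear_combination c * e3'

/-- The closure of the diagonal (equal to it, since the diagonal is closed). -/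
abbrev diagSub : Submodule ℂ (Lsp 2 × Lsp ∞) := diagSub₀.topologicalClosure

instance : IsClosed (diagSub : Set (Lsp 2 × Lsp ∞)) := diagSub₀.isClosed_topologicalClosure

/-- The Banach space `L²(ℝ³) + L^∞(ℝ³)` (with the quotient norm), realized as the quotient of
`L² × L^∞` by the diagonal. -/
abbrev L2plusLinf : Type := (Lsp 2 × Lsp ∞) ⧸ diagSub

/-- The (isometric) inclusion `L¹ ∩ L² ↪ L¹ × L²`. -/
abbrev inclι : L1capL2 →L[ℂ] (Lsp 1 × Lsp 2) := interSub.subtypeL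

/-- `F_H` is the Hartree operator, i.e. convolution against `1/|·|` on `ℝ³`; it is bounded
from `L¹ ∩ L²` to `L² + L^∞` by the Hardy–Littlewood–Sobolev inequality. -/
def IsHartree (FH : L1capL2 →L[ℂ] L2plusLinf) : Prop :=
  ∀ f : L1capL2, ∃ g : Lsp 2 × Lsp ∞,
    (Submodule.Quotient.mk g : L2plusLinf) = FH f ∧
    (fun x => (g.1 : R3 → ℂ) x + (g.2 : R3 → ℂ) x) =ᵐ[volume]
      (fun x => ∫ y : R3, ((‖x - y‖ : ℂ))⁻¹ * ((f.1.1 : R3 → ℂ) y))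

/-- Strong continuity of an operator-valued map on `ℝ₊`. -/
def SCont {E F : Type*} [SeminormedAddCommGroup E] [NormedSpace ℂ E]
    [SeminormedAddCommGroup F] [NormedSpace ℂ F] (χ : ℝ≥0 → (E →L[ℂ] F)) : Prop :=
  ∀ f : E, Continuous fun t => χ t f

/-- The RPA Dyson equation `χ(t) = χ₀(t) + ∫₀ᵗ χ₀(t−s) F_H χ(s) ds` for all `t ≥ 0`
(the integral being a Bochner integral, stated strongly). -/
def SolvesDyson (FH : L1capL2 →L[ℂ] L2plusLinf)
    (χ₀ χ : ℝ≥0 → (L2plusLinf →L[ℂ] L1capL2)) : Prop :=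
  ∀ (t : ℝ≥0) (f : L2plusLinf),
    IntervalIntegrable
      (fun s : ℝ => inclι (χ₀ (t - Real.toNNReal s) (FH (χ (Real.toNNReal s) f))))
      volume 0 (t : ℝ) ∧
    inclι (χ t f) = inclι (χ₀ t f) +
      ∫ s in (0:ℝ)..(t:ℝ), inclι (χ₀ (t - Real.toNNReal s) (FH (χ (Real.toNNReal s) f)))

/-- The set of strongly continuous operator-valued maps
`C_s(ℝ₊; B(L²+L^∞, L¹∩L²))`. -/
abbrev CsSpace : Type := {χ : ℝ≥0 → (L2plusLinf →L[ℂ] L1capL2) // SCont χ}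

section Abstract

variable {E F : Type*} [SeminormedAddCommGroup E] [NormedSpace ℂ E]
    [NormedAddCommGroup F] [NormedSpace ℂ F]

/-- Strongly continuous maps as an additive group. -/
def CsG (E F : Type*) [SeminormedAddCommGroup E] [NormedSpace ℂ E]
    [NormedAddCommGroup F] [NormedSpace ℂ F] : AddSubgroup (ℝ≥0 → (E →L[ℂ] F)) where
  carrier := {χ | SCont χ}
  add_mem' := by
    intro a b ha hb f
    exact (ha f).add (hb f)
  zero_mem' := by
    intro f
    exact continuous_const
  neg_mem' := by
    intro a ha f
    exact (ha f).neg

theorem locBdd [CompleteSpace E] (A : CsG E F) (T : ℝ≥0) :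
    ∃ M : ℝ, 0 ≤ M ∧ ∀ t ≤ T, ‖A.1 t‖ ≤ M := by
  have h : ∀ f : E, ∃ C, ∀ t : Set.Icc (0 : ℝ≥0) T, ‖A.1 t f‖ ≤ C := by
    intro f
    obtain ⟨C, hC⟩ := (isCompact_Icc (a := (0 : ℝ≥0)) (b := T)).exists_bound_of_continuousOn
      (A.2 f).continuousOn
    exact ⟨C, fun t => hC t.1 t.2⟩
  obtain ⟨M, hM⟩ := banach_steinhaus (g := fun t : Set.Icc (0 : ℝ≥0) T => A.1 t) h
  refine ⟨M, (norm_nonneg _).trans (hM ⟨0, by simp⟩), fun t ht => hM ⟨t, zero_le, ht⟩⟩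

theorem jointCont [CompleteSpace E] (A : CsG E F) {P : Type*} [TopologicalSpace P]
    {φ : P → ℝ≥0} {v : P → E} (hφ : Continuous φ) (hv : Continuous v) :
    Continuous fun p => A.1 (φ p) (v p) := by
  rw [continuous_iff_continuousAt]
  intro p₀
  obtain ⟨M, hM0, hM⟩ := locBdd A (φ p₀ + 1)
  have hev : ∀ᶠ p in nhds p₀, φ p ≤ φ p₀ + 1 := by
    have : ∀ᶠ p in nhds p₀, φ p < φ p₀ + 1 :=
      hφ.continuousAt.eventually_lt continuousAt_const (by simp)
    exact this.mono fun p hp => hp.le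
  have h1 : Filter.Tendsto (fun p => A.1 (φ p) (v p - v p₀)) (nhds p₀) (nhds 0) := by
    have h2 : Filter.Tendsto (fun p => M * ‖v p - v p₀‖) (nhds p₀) (nhds 0) := by
      have : Continuous fun p => M * ‖v p - v p₀‖ := by fun_prop
      simpa using this.tendsto p₀
    refine squeeze_zero_norm' ?_ h2
    filter_upwards [hev] with p hp
    exact (ContinuousLinearMap.le_opNorm _ _).trans
      (mul_le_mul_of_nonneg_right (hM _ hp) (norm_nonneg _))
  have h3 : Filter.Tendsto (fun p => A.1 (φ p) (v p₀)) (nhds p₀) (nhds (A.1 (φ p₀) (v p₀))) :=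
    ((A.2 (v p₀)).comp hφ).tendsto p₀
  have h4 := h1.add h3
  simp only [map_sub, sub_add_cancel, zero_add] at h4
  exact h4

theorem integrandCont [CompleteSpace E] (K : F →L[ℂ] E) (A B : CsG E F) (f : E) :
    Continuous (Function.uncurry fun (t : ℝ≥0) (s : ℝ) =>
      A.1 (t - Real.toNNReal s) (K (B.1 (Real.toNNReal s) f))) := by
  refine jointCont A (φ := fun p : ℝ≥0 × ℝ => p.1 - Real.toNNReal p.2)
    (v := fun p : ℝ≥0 × ℝ => K (B.1 (Real.toNNReal p.2) f)) ?_ ?_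
  · exact continuous_fst.sub (continuous_real_toNNReal.comp continuous_snd)
  · exact K.continuous.comp ((B.2 f).comp (continuous_real_toNNReal.comp continuous_snd))

theorem integrandCont' [CompleteSpace E] (K : F →L[ℂ] E) (A B : CsG E F) (f : E) (t : ℝ≥0) :
    Continuous fun s : ℝ =>
      A.1 (t - Real.toNNReal s) (K (B.1 (Real.toNNReal s) f)) :=
  (integrandCont K A B f).comp (Continuous.prodMk_right t)

theorem convBound (K : F →L[ℂ] E) (A B : CsG E F) (t : ℝ≥0)
    (g : ℝ → ℝ) (hg : Continuous g)
    (h : ∀ s ≤ t, ‖A.1 (t - s)‖ * ‖K‖ * ‖B.1 s‖ ≤ g s) (f : E) :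
    ‖∫ s in (0:ℝ)..(t:ℝ), A.1 (t - Real.toNNReal s) (K (B.1 (Real.toNNReal s) f))‖ ≤
      (∫ s in (0:ℝ)..(t:ℝ), g s) * ‖f‖ := by
  rw [← intervalIntegral.integral_mul_const]
  refine intervalIntegral.norm_integral_le_of_norm_le t.2 ?_
    ((hg.mul continuous_const).intervalIntegrable _ _)
  refine Filter.Eventually.of_forall fun s hs => ?_
  have hs0 : 0 ≤ s := hs.1.le
  lift s to ℝ≥0 using hs0
  have hst : s ≤ t := by exact_mod_cast hs.2
  rw [Real.toNNReal_coe]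
  calc _ ≤ ‖A.1 (t - s)‖ * (‖K‖ * (‖B.1 s‖ * ‖f‖)) := by
        refine (ContinuousLinearMap.le_opNorm _ _).trans ?_
        gcongr
        refine (ContinuousLinearMap.le_opNorm _ _).trans ?_
        gcongr
        exact ContinuousLinearMap.le_opNorm _ _
    _ = (‖A.1 (t - s)‖ * ‖K‖ * ‖B.1 s‖) * ‖f‖ := by ring
    _ ≤ g s * ‖f‖ := by gcongr; exact h s hst

theorem convBddExists [CompleteSpace E] (K : F →L[ℂ] E) (A B : CsG E F) (t : ℝ≥0) :
    ∃ C : ℝ, ∀ f : E,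
    ‖∫ s in (0:ℝ)..(t:ℝ), A.1 (t - Real.toNNReal s) (K (B.1 (Real.toNNReal s) f))‖ ≤
      C * ‖f‖ := by
  obtain ⟨a, ha0, ha⟩ := locBdd A t
  obtain ⟨b, hb0, hb⟩ := locBdd B t
  refine ⟨_, convBound K A B t (fun _ => a * ‖K‖ * b) continuous_const ?_⟩
  intro s hs
  have h1 := ha (t - s) tsub_le_self
  have h2 := hb s hs
  gcongr

/-- Convolution at a time `t`. -/
def convOp [CompleteSpace E] (K : F →L[ℂ] E) (A B : CsG E F) (t : ℝ≥0) : E →L[ℂ] F :=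
  LinearMap.mkContinuousOfExistsBound
    { toFun := fun f => ∫ s in (0:ℝ)..(t:ℝ),
        A.1 (t - Real.toNNReal s) (K (B.1 (Real.toNNReal s) f))
      map_add' := by
        intro f g
        simp only [map_add]
        exact intervalIntegral.integral_add
          ((integrandCont' K A B f t).intervalIntegrable _ _)
          ((integrandCont' K A B g t).intervalIntegrable _ _)
      map_smul' := by
        intro c f
        simp only [map_smul, RingHom.id_apply]
        exact intervalIntegral.integral_smul c _ }
    (convBddExists K A B t)

theorem convOp_apply [CompleteSpace E] (K : F →L[ℂ] E) (A B : CsG E F) (t : ℝ≥0) (f : E) :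
    convOp K A B t f = ∫ s in (0:ℝ)..(t:ℝ),
        A.1 (t - Real.toNNReal s) (K (B.1 (Real.toNNReal s) f)) := rfl

/-- Convolution. -/
def conv [CompleteSpace E] (K : F →L[ℂ] E) (A B : CsG E F) : CsG E F :=
  ⟨fun t => convOp K A B t, fun f => by
    simp only [convOp_apply]
    exact intervalIntegral.continuous_parametric_intervalIntegral_of_continuous
      (integrandCont K A B f) NNReal.continuous_coe⟩

theorem conv_apply [CompleteSpace E] (K : F →L[ℂ] E) (A B : CsG E F) (t : ℝ≥0) (f : E) :
    (conv K A B).1 t f = ∫ s in (0:ℝ)..(t:ℝ),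
        A.1 (t - Real.toNNReal s) (K (B.1 (Real.toNNReal s) f)) := rfl

theorem csg_ext {A B : CsG E F} (h : ∀ t f, A.1 t f = B.1 t f) : A = B := by
  apply Subtype.ext
  funext t
  exact ContinuousLinearMap.ext (h t)

theorem conv_add_right [CompleteSpace E] (K : F →L[ℂ] E) (A B C : CsG E F) :
    conv K A (B + C) = conv K A B + conv K A C := by
  refine csg_ext fun t f => ?_
  have := intervalIntegral.integral_add (a := (0:ℝ)) (b := t) (μ := volume)
          ((integrandCont' K A B f t).intervalIntegrable _ _)
          ((integrandCont' K A C f t).intervalIntegrable _ _)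
  refine Eq.trans ?_ this
  rw [conv_apply]
  congr 1
  funext s
  rw [← map_add, ← map_add]
  rfl

theorem conv_add_left [CompleteSpace E] (K : F →L[ℂ] E) (A B C : CsG E F) :
    conv K (A + B) C = conv K A C + conv K B C :=
  csg_ext fun t f => intervalIntegral.integral_add
          ((integrandCont' K A C f t).intervalIntegrable _ _)
          ((integrandCont' K B C f t).intervalIntegrable _ _)

/-- Volterra-type maps. -/
def IsVolt (V : CsG E F →+ CsG E F) : Prop :=
  ∀ T : ℝ≥0, ∃ l : ℝ, 0 ≤ l ∧ ∀ (X : CsG E F) (c : ℝ), 0 ≤ c →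
    (∀ s ≤ T, ‖X.1 s‖ ≤ c * Real.exp (l * s)) →
    ∀ t ≤ T, ‖(V X).1 t‖ ≤ (c / 2) * Real.exp (l * t)

theorem expInt (l : ℝ) (hl : 0 < l) (t : ℝ) :
    (∫ s in (0:ℝ)..t, Real.exp (l * s)) ≤ Real.exp (l * t) / l := by
  rw [intervalIntegral.integral_comp_mul_left (fun x => Real.exp x) hl.ne', integral_exp,
    smul_eq_mul, div_eq_inv_mul]
  have := Real.exp_pos (l * 0)
  gcongr
  linarith

theorem expInt' (l : ℝ) (hl : 0 < l) (t : ℝ) :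
    (∫ s in (0:ℝ)..t, Real.exp (l * (t - s))) ≤ Real.exp (l * t) / l := by
  rw [intervalIntegral.integral_comp_sub_left (fun x => Real.exp (l * x)) t]
  simpa using expInt l hl t

theorem volt_unique [CompleteSpace E] (V : CsG E F →+ CsG E F) (hV : IsVolt V)
    (D : CsG E F) (hD : D = V D) : D = 0 := by
  apply Subtype.ext
  funext T
  obtain ⟨l, hl, h⟩ := hV T
  obtain ⟨M, hM0, hM⟩ := locBdd D T
  have key : ∀ n : ℕ, ∀ s ≤ T, ‖D.1 s‖ ≤ (M * (1 / 2) ^ n) * Real.exp (l * s) := by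
    intro n
    induction n with
    | zero =>
      intro s hs
      have h1 : 1 ≤ Real.exp (l * s) := Real.one_le_exp (by positivity)
      have := hM s hs
      simp only [pow_zero, mul_one]
      nlinarith
    | succ n ih =>
      intro s hs
      have := h D _ (by positivity) ih s hs
      rw [← hD] at this
      refine this.trans (le_of_eq ?_)
      ring
  have hlim : Filter.Tendsto (fun n : ℕ => (M * (1 / 2 : ℝ) ^ n) * Real.exp (l * T))
      Filter.atTop (nhds 0) := by
    have := (tendsto_pow_atTop_nhds_zero_of_lt_one (r := (1 / 2 : ℝ)) (by norm_num)
      (by norm_num)).const_mul M |>.mul_const (Real.exp (l * T))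
    simpa using this
  have := ge_of_tendsto' hlim (fun n => key n T le_rfl)
  refine ContinuousLinearMap.ext fun f => ?_
  have h2 := ContinuousLinearMap.le_of_opNorm_le _ this f
  rw [zero_mul] at h2
  exact norm_le_zero_iff.mp h2

theorem volt_exists [CompleteSpace E] [CompleteSpace F] (V : CsG E F →+ CsG E F) (hV : IsVolt V)
    (A : CsG E F) : ∃ X, X = A + V X := by
  let P : ℕ → CsG E F := fun n => Nat.rec 0 (fun _ Y => A + V Y) n
  have P0 : P 0 = 0 := rfl
  have PS : ∀ n, P (n + 1) = A + V (P n) := fun n => rfl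
  have bd : ∀ T : ℝ≥0, ∃ l : ℝ, ∃ M : ℝ, 0 ≤ l ∧ 0 ≤ M ∧
      (∀ (X : CsG E F) (c : ℝ), 0 ≤ c →
      (∀ s ≤ T, ‖X.1 s‖ ≤ c * Real.exp (l * s)) →
      ∀ t ≤ T, ‖(V X).1 t‖ ≤ (c / 2) * Real.exp (l * t)) ∧
      ∀ n : ℕ, ∀ s ≤ T, ‖(P (n + 1) - P n).1 s‖ ≤ (M * (1 / 2) ^ n) * Real.exp (l * s) := by
    intro T
    obtain ⟨l, hl, h⟩ := hV T
    obtain ⟨M, hM0, hM⟩ := locBdd A T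
    refine ⟨l, M, hl, hM0, h, fun n => ?_⟩
    induction n with
    | zero =>
      intro s hs
      have h1 : 1 ≤ Real.exp (l * s) := Real.one_le_exp (by positivity)
      have := hM s hs
      rw [PS, P0, map_zero, add_zero, sub_zero]
      simp only [pow_zero, mul_one]
      nlinarith
    | succ n ih =>
      intro s hs
      have := h _ _ (by positivity) ih s hs
      have e : P (n + 1 + 1) - P (n + 1) = V (P (n + 1) - P n) := by
        rw [PS (n + 1), map_sub, PS n]
        abel
      rw [e]
      refine this.trans (le_of_eq ?_)
      ring
  have step : ∀ T : ℝ≥0, ∃ l : ℝ, ∃ M : ℝ, 0 ≤ l ∧ 0 ≤ M ∧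
      (∀ (X : CsG E F) (c : ℝ), 0 ≤ c →
      (∀ s ≤ T, ‖X.1 s‖ ≤ c * Real.exp (l * s)) →
      ∀ t ≤ T, ‖(V X).1 t‖ ≤ (c / 2) * Real.exp (l * t)) ∧
      ∀ s ≤ T, ∀ n : ℕ, dist ((P n).1 s) ((P (n + 1)).1 s) ≤
        (M * Real.exp (l * s)) * (1 / 2) ^ n := by
    intro T
    obtain ⟨l, M, hl, hM, h, h'⟩ := bd T
    refine ⟨l, M, hl, hM, h, fun s hs n => ?_⟩
    rw [dist_comm, dist_eq_norm]
    refine (h' n s hs).trans (le_of_eq ?_)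
    ring
  have conv : ∀ t : ℝ≥0, ∃ Y : E →L[ℂ] F,
      Filter.Tendsto (fun n => (P n).1 t) Filter.atTop (nhds Y) := by
    intro t
    obtain ⟨l, M, hl, hM, h, h'⟩ := step t
    exact cauchySeq_tendsto_of_complete
      (cauchySeq_of_le_geometric _ _ (by norm_num) (h' t le_rfl))
  choose X hX using conv
  have tail : ∀ T : ℝ≥0, ∃ l : ℝ, ∃ M : ℝ, 0 ≤ l ∧ 0 ≤ M ∧
      (∀ (X : CsG E F) (c : ℝ), 0 ≤ c →
      (∀ s ≤ T, ‖X.1 s‖ ≤ c * Real.exp (l * s)) →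
      ∀ t ≤ T, ‖(V X).1 t‖ ≤ (c / 2) * Real.exp (l * t)) ∧
      ∀ s ≤ T, ∀ n : ℕ, ‖X s - (P n).1 s‖ ≤ (M * (1 / 2) ^ n) * Real.exp (l * s) := by
    intro T
    obtain ⟨l, M, hl, hM, h, h'⟩ := step T
    refine ⟨l, 2 * M, hl, by positivity, h, fun s hs n => ?_⟩
    have := dist_le_of_le_geometric_of_tendsto _ _ (by norm_num) (h' s hs) (hX s) n
    rw [← dist_eq_norm, dist_comm]
    refine this.trans (le_of_eq ?_)
    ring
  have zlim : ∀ a b : ℝ, Filter.Tendsto (fun n : ℕ => (a * (1 / 2 : ℝ) ^ n) * b)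
      Filter.atTop (nhds 0) := by
    intro a b
    have := (tendsto_pow_atTop_nhds_zero_of_lt_one (r := (1 / 2 : ℝ)) (by norm_num)
      (by norm_num)).const_mul a |>.mul_const b
    simpa using this
  have hXc : SCont X := by
    intro f
    rw [continuous_iff_continuousAt]
    intro t
    obtain ⟨l, M, hl, hM, h, h'⟩ := tail (t + 1)
    have hu : TendstoUniformlyOn (fun (n : ℕ) s => (P n).1 s f) (fun s => X s f)
        Filter.atTop (Set.Iic (t + 1)) := by
      rw [Metric.tendstoUniformlyOn_iff]
      intro ε hε
      have := (zlim M (Real.exp (l * (t + 1)) * ‖f‖)).eventually_lt_const hε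
      filter_upwards [this] with n hn s hs
      have hs' : s ≤ t + 1 := hs
      have hs'' : (s : ℝ) ≤ t + 1 := by exact_mod_cast hs'
      refine lt_of_le_of_lt ?_ hn
      rw [dist_eq_norm, ← sub_apply]
      refine (ContinuousLinearMap.le_opNorm _ _).trans ?_
      rw [← mul_assoc]
      gcongr
      refine (h' s hs' n).trans ?_
      gcongr
    have hc := hu.continuousOn (Filter.Frequently.of_forall fun n => ((P n).2 f).continuousOn)
    exact hc.continuousAt (Iic_mem_nhds (by simp))
  refine ⟨⟨X, hXc⟩, ?_⟩
  apply Subtype.ext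
  funext t
  obtain ⟨l, M, hl, hM, h, h'⟩ := tail t
  have h1 : Filter.Tendsto (fun n => (V (P n)).1 t) Filter.atTop (nhds ((V ⟨X, hXc⟩).1 t)) := by
    rw [tendsto_iff_norm_sub_tendsto_zero]
    refine squeeze_zero (fun _ => norm_nonneg _) (fun n => ?_) (zlim (M / 2) (Real.exp (l * t)))
    have := h (⟨X, hXc⟩ - P n) (M * (1 / 2) ^ n) (by positivity) (fun s hs => h' s hs n) t le_rfl
    rw [map_sub] at this
    rw [norm_sub_rev]
    refine le_trans this (le_of_eq ?_)
    ring
  have h2 : Filter.Tendsto (fun n => (P (n + 1)).1 t) Filter.atTop (nhds (X t)) :=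
    (hX t).comp (Filter.tendsto_add_atTop_nat 1)
  exact tendsto_nhds_unique h2 (h1.const_add (A.1 t))

theorem convOp_norm_le [CompleteSpace E] (K : F →L[ℂ] E) (A B : CsG E F) (t : ℝ≥0)
    (g : ℝ → ℝ) (hg : Continuous g)
    (h : ∀ s ≤ t, ‖A.1 (t - s)‖ * ‖K‖ * ‖B.1 s‖ ≤ g s) (C : ℝ)
    (hC : (∫ s in (0:ℝ)..(t:ℝ), g s) ≤ C) (hC0 : 0 ≤ C) :
    ‖(conv K A B).1 t‖ ≤ C := by
  refine ContinuousLinearMap.opNorm_le_bound _ hC0 fun f => ?_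
  refine (convBound K A B t g hg h f).trans ?_
  gcongr

/-- Left convolution. -/
def convL [CompleteSpace E] (K : F →L[ℂ] E) (A : CsG E F) : CsG E F →+ CsG E F :=
  AddMonoidHom.mk' (fun X => conv K A X) (conv_add_right K A)

/-- Right convolution. -/
def convR [CompleteSpace E] (K : F →L[ℂ] E) (B : CsG E F) : CsG E F →+ CsG E F :=
  AddMonoidHom.mk' (fun X => conv K X B) (fun X Y => conv_add_left K X Y B)

theorem arith_aux (m c x : ℝ) (hm : 0 ≤ m) (hc : 0 ≤ c) (hx : 0 ≤ x) :
    (m * c) * (x / (2 * m + 1)) ≤ c / 2 * x := by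
  have h : m / (2 * m + 1) ≤ 1 / 2 := by
    rw [div_le_div_iff₀ (by positivity) (by norm_num)]
    linarith
  calc (m * c) * (x / (2 * m + 1)) = (m / (2 * m + 1)) * (c * x) := by ring
    _ ≤ (1 / 2) * (c * x) := by gcongr
    _ = c / 2 * x := by ring

theorem convL_volt [CompleteSpace E] (K : F →L[ℂ] E) (A : CsG E F) : IsVolt (convL K A) := by
  intro T
  obtain ⟨a, ha0, ha⟩ := locBdd A T
  refine ⟨2 * (a * ‖K‖) + 1, by positivity, fun X c hc hX t ht => ?_⟩
  refine convOp_norm_le K A X t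
    (fun s => (a * ‖K‖ * c) * Real.exp ((2 * (a * ‖K‖) + 1) * s)) (by fun_prop) ?_ _ ?_
    (by positivity)
  · intro s hs
    have h1 := ha (t - s) (tsub_le_self.trans ht)
    have h2 := hX s (hs.trans ht)
    rw [mul_assoc (a * ‖K‖)]
    gcongr
  · rw [intervalIntegral.integral_const_mul]
    refine le_trans ?_ (arith_aux (a * ‖K‖) c _ (by positivity) hc (Real.exp_pos _).le)
    gcongr
    exact expInt _ (by positivity) t

theorem convR_volt [CompleteSpace E] (K : F →L[ℂ] E) (B : CsG E F) : IsVolt (convR K B) := by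
  intro T
  obtain ⟨b, hb0, hb⟩ := locBdd B T
  refine ⟨2 * (b * ‖K‖) + 1, by positivity, fun X c hc hX t ht => ?_⟩
  refine convOp_norm_le K X B t
    (fun s => (b * ‖K‖ * c) * Real.exp ((2 * (b * ‖K‖) + 1) * (t - s))) (by fun_prop) ?_ _ ?_
    (by positivity)
  · intro s hs
    have h1 := hb s (hs.trans ht)
    have h2 := hX (t - s) (tsub_le_self.trans ht)
    rw [NNReal.coe_sub hs] at h2
    calc ‖X.1 (t - s)‖ * ‖K‖ * ‖B.1 s‖
        ≤ (c * Real.exp ((2 * (b * ‖K‖) + 1) * (t - s))) * ‖K‖ * b := by gcongr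
      _ = _ := by ring
  · rw [intervalIntegral.integral_const_mul]
    refine le_trans ?_ (arith_aux (b * ‖K‖) c _ (by positivity) hc (Real.exp_pos _).le)
    gcongr
    exact expInt' _ (by positivity) t

theorem volt_neg (V : CsG E F →+ CsG E F) (hV : IsVolt V) : IsVolt (-V) := by
  intro T
  obtain ⟨l, hl, h⟩ := hV T
  refine ⟨l, hl, fun X c hc hX t ht => ?_⟩
  have := h X c hc hX t ht
  have e : ((-V) X).1 t = - (V X).1 t := rfl
  rwa [e, norm_neg]

theorem volt_inj [CompleteSpace E] (V : CsG E F →+ CsG E F) (hV : IsVolt V)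
    (A X Y : CsG E F) (hX : X = A + V X) (hY : Y = A + V Y) : X = Y := by
  refine sub_eq_zero.mp (volt_unique V hV (X - Y) ?_)
  rw [map_sub]
  nth_rewrite 1 [hX, hY]
  abel

end Abstract

theorem interSub_closed : IsClosed (interSub : Set (Lsp 1 × Lsp 2)) := by
  apply IsSeqClosed.isClosed
  intro u x hu hx
  have h1 : Filter.Tendsto (fun n => (u n).1) Filter.atTop (nhds x.1) :=
    (continuous_fst.tendsto x).comp hx
  have h2 : Filter.Tendsto (fun n => (u n).2) Filter.atTop (nhds x.2) :=
    (continuous_snd.tendsto x).comp hx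
  have m1 := tendstoInMeasure_of_tendsto_Lp h1
  have m2 := tendstoInMeasure_of_tendsto_Lp h2
  have m1' := m1.congr_left (fun n => (hu n : ((u n).1 : R3 → ℂ) =ᵐ[volume] ((u n).2 : R3 → ℂ)))
  exact tendstoInMeasure_ae_unique m1' m2

instance : CompleteSpace L1capL2 := interSub_closed.completeSpace_coe

theorem solves_iff (FH : L1capL2 →L[ℂ] L2plusLinf) (A X : CsG L2plusLinf L1capL2) :
    SolvesDyson FH A.1 X.1 ↔ X = A + conv FH A X := by
  have key : ∀ (t : ℝ≥0) (f : L2plusLinf),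
      (∫ s in (0:ℝ)..(t:ℝ), inclι (A.1 (t - Real.toNNReal s) (FH (X.1 (Real.toNNReal s) f))))
       = inclι ((conv FH A X).1 t f) := by
    intro t f
    rw [conv_apply]
    exact ContinuousLinearMap.intervalIntegral_comp_comm inclι
      ((integrandCont' FH A X f t).intervalIntegrable _ _)
  constructor
  · intro h
    refine csg_ext fun t f => ?_
    have h2 := (h t f).2
    rw [key, ← map_add] at h2
    exact Subtype.ext h2
  · intro h t f
    refine ⟨(inclι.continuous.comp (integrandCont' FH A X f t)).intervalIntegrable _ _, ?_⟩
    rw [key, ← map_add]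
    nth_rewrite 1 [h]
    rfl

/-- Theorem 1.1 (ii): the RPA solution map `S^RPA : χ₀ ↦ χ^RPA`, sending a
strongly continuous reference response function to the unique strongly continuous solution of
the RPA Dyson equation, exists and is a bijection of `C_s(ℝ₊; B(L²+L^∞, L¹∩L²))` onto itself. -/
theorem rpa_solution_map_bijective
    (FH : L1capL2 →L[ℂ] L2plusLinf) (hFH : IsHartree FH) :
    (∃ SRPA : CsSpace → CsSpace,
        (∀ χ₀ : CsSpace, SolvesDyson FH χ₀.1 (SRPA χ₀).1) ∧ Function.Bijective SRPA) ∧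
    (∀ SRPA : CsSpace → CsSpace,
        (∀ χ₀ : CsSpace, SolvesDyson FH χ₀.1 (SRPA χ₀).1) → Function.Bijective SRPA) := by
  have uniq : ∀ χ₀ χ χ' : CsSpace, SolvesDyson FH χ₀.1 χ.1 → SolvesDyson FH χ₀.1 χ'.1 →
      χ = χ' := by
    intro A X Y hX hY
    exact volt_inj (E := L2plusLinf) (F := L1capL2) (convL FH A) (convL_volt FH A) A X Y
      ((solves_iff FH A X).1 hX) ((solves_iff FH A Y).1 hY)
  have exis : ∀ χ₀ : CsSpace, ∃ χ : CsSpace, SolvesDyson FH χ₀.1 χ.1 := by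
    intro A
    obtain ⟨X, hX⟩ := volt_exists (E := L2plusLinf) (F := L1capL2) (convL FH A)
      (convL_volt FH A) A
    exact ⟨X, (solves_iff FH A X).2 hX⟩
  have uniq' : ∀ χ₀ χ₀' χ : CsSpace, SolvesDyson FH χ₀.1 χ.1 → SolvesDyson FH χ₀'.1 χ.1 →
      χ₀ = χ₀' := by
    intro A B X hA hB
    refine volt_inj (E := L2plusLinf) (F := L1capL2) (-convR FH X)
      (volt_neg _ (convR_volt FH X)) X A B ?_ ?_
    · exact eq_add_neg_of_add_eq ((solves_iff FH A X).1 hA).symm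
    · exact eq_add_neg_of_add_eq ((solves_iff FH B X).1 hB).symm
  have exis' : ∀ χ : CsSpace, ∃ χ₀ : CsSpace, SolvesDyson FH χ₀.1 χ.1 := by
    intro X
    obtain ⟨A, hA⟩ := volt_exists (E := L2plusLinf) (F := L1capL2) (-convR FH X)
      (volt_neg _ (convR_volt FH X)) X
    exact ⟨A, (solves_iff FH A X).2 (add_eq_of_eq_add_neg hA).symm⟩
  have bij : ∀ SRPA : CsSpace → CsSpace,
      (∀ χ₀ : CsSpace, SolvesDyson FH χ₀.1 (SRPA χ₀).1) → Function.Bijective SRPA := by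
    intro S hS
    refine ⟨fun A B hAB => ?_, fun X => ?_⟩
    · have hA := hS A
      rw [hAB] at hA
      exact uniq' A B (S B) hA (hS B)
    · obtain ⟨A, hA⟩ := exis' X
      exact ⟨A, uniq A _ _ (hS A) hA⟩
  refine ⟨?_, bij⟩
  choose S hS using exis
  exact ⟨S, hS, bij S hS⟩


end
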